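/- Let v be a monotone submodular set function on {1,…,n} with v(∅) = 0 and all marginal values at most 1 (i.e., v(S ∪ {i}) − v(S) ≤ 1 for all S and i). Let x ∈ [0,1]^n, let μ = F(x) be the value of the multilinear extension of v at x, and let δ ∈ (0,1). Then ∑_{S ⊆ {1,…,n} : v(S) ≤ (1−δ)μ} ∏_{j∈S} x_j ∏_{j∉S} (1 − x_j) ≤ exp(−δ²μ/2); that is, if V is a random subset including each element j independently with probability x_j, then Pr[v(V) ≤ (1−δ)μ] ≤ e^{−δ²μ/2}. -/

import Mathlib

/-- The multilinear extension of a set function `v` on ground set `{1,…,n}`: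
`F(x) = ∑_{S ⊆ [n]} v(S) ∏_{j∈S} x_j ∏_{j∉S} (1 - x_j)`. -/
noncomputable def multilinear (n : ℕ) (v : Finset (Fin n) → ℝ) (x : Fin n → ℝ) : ℝ :=
  ∑ S : Finset (Fin n), v S * ((∏ j ∈ S, x j) * ∏ j ∈ Sᶜ, (1 - x j))

noncomputable def pw {n : ℕ} (x : Fin n → ℝ) (S : Finset (Fin n)) : ℝ :=
  (∏ j ∈ S, x j) * ∏ j ∈ Sᶜ, (1 - x j)

lemma pw_eq {n : ℕ} (x : Fin n → ℝ) (S : Finset (Fin n)) :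
    pw x S = ∏ j, if j ∈ S then x j else 1 - x j := by
  rw [Finset.prod_ite]
  unfold pw
  congr 1
  · congr 1; ext; simp
  · congr 1; ext; simp

lemma pw_nonneg {n : ℕ} (x : Fin n → ℝ) (hx : ∀ j, x j ∈ Set.Icc (0:ℝ) 1)
    (S : Finset (Fin n)) : 0 ≤ pw x S := by
  unfold pw
  exact mul_nonneg (Finset.prod_nonneg fun j _ => (hx j).1)
    (Finset.prod_nonneg fun j _ => sub_nonneg.2 (hx j).2)

lemma pw_sum {n : ℕ} (x : Fin n → ℝ) : ∑ S, pw x S = 1 := by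
  unfold pw
  rw [← Fintype.prod_add]
  simp

lemma pw_mod {n : ℕ} (x : Fin n → ℝ) (S T : Finset (Fin n)) :
    pw x S * pw x T = pw x (S ∩ T) * pw x (S ∪ T) := by
  simp only [pw_eq, ← Finset.prod_mul_distrib]
  refine Finset.prod_congr rfl fun j _ => ?_
  by_cases h1 : j ∈ S <;> by_cases h2 : j ∈ T <;> simp [h1, h2, mul_comm]

lemma pw_insert {n : ℕ} (x : Fin n → ℝ) (a : Fin n) (S : Finset (Fin n)) (ha : a ∉ S) :
    x a * (pw x S + pw x (insert a S)) = pw x (insert a S) := by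
  rw [pw_eq, pw_eq, ← Finset.mul_prod_erase _ _ (Finset.mem_univ a),
    ← Finset.mul_prod_erase _ (fun j => if j ∈ insert a S then x j else 1 - x j)
      (Finset.mem_univ a)]
  have : ∏ j ∈ Finset.univ.erase a, (if j ∈ insert a S then x j else 1 - x j)
      = ∏ j ∈ Finset.univ.erase a, (if j ∈ S then x j else 1 - x j) := by
    refine Finset.prod_congr rfl fun j hj => ?_
    simp [Finset.ne_of_mem_erase hj]
  rw [this]
  simp only [ha, Finset.mem_insert_self, if_true, if_false]
  ring

lemma pw_indep {n : ℕ} (x : Fin n → ℝ) (a : Fin n) (f : Finset (Fin n) → ℝ)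
    (hf : ∀ S, f (insert a S) = f S) :
    ∑ S, pw x S * (if a ∈ S then f S else 0) = x a * ∑ S, pw x S * f S := by
  have key : ∀ g : Finset (Fin n) → ℝ, ∑ S, g S =
      ∑ S ∈ (Finset.univ.erase a).powerset, (g S + g (insert a S)) := by
    intro g
    rw [Finset.sum_add_distrib, ← Finset.sum_powerset_insert (Finset.notMem_erase a _),
      Finset.insert_erase (Finset.mem_univ a), Finset.powerset_univ]
  rw [key, key, Finset.mul_sum]
  refine Finset.sum_congr rfl fun S hS => ?_
  have ha : a ∉ S := fun h => Finset.notMem_erase a _ (Finset.mem_powerset.1 hS h)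
  simp only [ha, hf, Finset.mem_insert_self, if_true, if_false]
  rw [← pw_insert x a S ha]
  have := pw_insert x a S ha
  linear_combination (-f S * x a) * this

lemma exp_chord (l y : ℝ) (h0 : 0 ≤ y) (h1 : y ≤ 1) :
    Real.exp (l * y) ≤ 1 + (Real.exp l - 1) * y := by
  have := convexOn_exp.2 (Set.mem_univ (0:ℝ)) (Set.mem_univ l) (sub_nonneg.2 h1) h0 (by ring)
  simp only [smul_eq_mul, mul_zero, zero_add, Real.exp_zero, mul_one] at this
  rw [mul_comm l y]
  linarith

lemma pw_harris {n : ℕ} (x : Fin n → ℝ) (hx : ∀ j, x j ∈ Set.Icc (0:ℝ) 1)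
    (h g : Finset (Fin n) → ℝ) (hh : Antitone h) (hh1 : ∀ S, h S ≤ 1)
    (hg : Monotone g) (hg0 : ∀ S, 0 ≤ g S) :
    ∑ S, pw x S * (h S * g S) ≤ (∑ S, pw x S * h S) * ∑ S, pw x S * g S := by
  have := fkg (μ := pw x) (f := fun S => 1 - h S) (g := g) (fun S => pw_nonneg x hx S)
    (fun S => sub_nonneg.2 (hh1 S)) hg0 (fun S T hST => sub_le_sub_left (hh hST) 1) hg
    (fun S T => (pw_mod x S T).le)
  rw [pw_sum] at this
  simp only [mul_sub, sub_mul, Finset.sum_sub_distrib, mul_one, one_mul, pw_sum] at this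
  linarith

lemma mgf_bound (n : ℕ) (v : Finset (Fin n) → ℝ)
    (hmono : ∀ S T : Finset (Fin n), S ⊆ T → v S ≤ v T)
    (hsub : ∀ S T : Finset (Fin n), v S + v T ≥ v (S ∩ T) + v (S ∪ T))
    (h0 : v ∅ = 0)
    (hmarg : ∀ (S : Finset (Fin n)) (i : Fin n), v (insert i S) - v S ≤ 1)
    (x : Fin n → ℝ) (hx : ∀ j, x j ∈ Set.Icc (0:ℝ) 1) (l : ℝ) (hl : l ≤ 0)
    (A : Finset (Fin n)) :
    ∑ S, pw x S * Real.exp (l * v (S ∩ A)) ≤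
      Real.exp ((Real.exp l - 1) * ∑ S, pw x S * v (S ∩ A)) := by
  induction A using Finset.induction_on with
  | empty => simp [h0, pw_sum]
  | insert a A ha ih =>
    set c := Real.exp l - 1 with hc
    have hc0 : c ≤ 0 := by have := Real.exp_le_one_iff.2 hl; linarith
    have hc1 : -1 ≤ c := by have := Real.exp_pos l; linarith
    set d : Finset (Fin n) → ℝ := fun S => v (insert a (S ∩ A)) - v (S ∩ A) with hd
    have hd0 : ∀ S, 0 ≤ d S := fun S => sub_nonneg.2 (hmono _ _ (Finset.subset_insert _ _))
    have hd1 : ∀ S, d S ≤ 1 := fun S => hmarg _ _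
    have hins : ∀ S : Finset (Fin n), insert a S ∩ A = S ∩ A :=
      fun S => Finset.insert_inter_of_notMem ha
    have hdanti : Antitone d := by
      intro S T hST
      have h1 := hsub (insert a (S ∩ A)) (T ∩ A)
      have hST' : S ∩ A ⊆ T ∩ A := Finset.inter_subset_inter_right hST
      have e1 : insert a (S ∩ A) ∩ (T ∩ A) = S ∩ A := by
        rw [Finset.insert_inter_of_notMem (by simp [ha])]
        exact Finset.inter_eq_left.2 hST'
      have e2 : insert a (S ∩ A) ∪ (T ∩ A) = insert a (T ∩ A) := by
        rw [Finset.insert_union, Finset.union_eq_right.2 hST']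
      rw [e1, e2] at h1
      simp only [hd]
      linarith
    have hv : ∀ S, v (S ∩ insert a A) = v (S ∩ A) + if a ∈ S then d S else 0 := by
      intro S
      by_cases h : a ∈ S
      · simp [h, hd, Finset.inter_insert_of_mem h]
      · simp [h, Finset.inter_insert_of_notMem h]
    set e : Finset (Fin n) → ℝ := fun S => Real.exp (l * v (S ∩ A)) with he
    have hE : ∑ S, pw x S * v (S ∩ insert a A)
        = ∑ S, pw x S * v (S ∩ A) + x a * ∑ S, pw x S * d S := by
      rw [← pw_indep x a d (fun S => by simp only [hd, hins]), ← Finset.sum_add_distrib]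
      refine Finset.sum_congr rfl fun S _ => ?_
      rw [hv, mul_add]
    calc ∑ S, pw x S * Real.exp (l * v (S ∩ insert a A))
        ≤ ∑ S, pw x S * (e S + c * (if a ∈ S then e S * d S else 0)) := by
          refine Finset.sum_le_sum fun S _ => mul_le_mul_of_nonneg_left ?_ (pw_nonneg x hx S)
          rw [hv]
          by_cases h : a ∈ S
          · simp only [h, if_true]
            rw [mul_add, Real.exp_add]
            have := mul_le_mul_of_nonneg_left (exp_chord l (d S) (hd0 S) (hd1 S))
              (Real.exp_pos (l * v (S ∩ A))).le
            simp only [he]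
            linarith
          · simp [h, he]
      _ = ∑ S, pw x S * (e S * (1 + c * x a * d S)) := by
          have := pw_indep x a (fun S => e S * d S) (fun S => by simp only [hd, he, hins])
          simp only [mul_add, Finset.sum_add_distrib, mul_one]
          congr 1
          calc _ = c * ∑ S, pw x S * (if a ∈ S then e S * d S else 0) := by
                rw [Finset.mul_sum]
                exact Finset.sum_congr rfl fun S _ => by ring
            _ = _ := by
                rw [this, Finset.mul_sum, Finset.mul_sum]
                exact Finset.sum_congr rfl fun S _ => by ring
      _ ≤ (∑ S, pw x S * e S) * ∑ S, pw x S * (1 + c * x a * d S) := by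
          have hcx : c * x a ≤ 0 := mul_nonpos_of_nonpos_of_nonneg hc0 (hx a).1
          apply pw_harris x hx
          · intro S T hST
            refine Real.exp_le_exp.2 (mul_le_mul_of_nonpos_left ?_ hl)
            exact hmono _ _ (Finset.inter_subset_inter_right hST)
          · intro S
            refine Real.exp_le_one_iff.2 (mul_nonpos_of_nonpos_of_nonneg hl ?_)
            rw [← h0]
            exact hmono _ _ (Finset.empty_subset _)
          · intro S T hST
            have := mul_le_mul_of_nonpos_left (hdanti hST) hcx
            simpa using this
          · intro S
            have h1 : x a * d S ≤ 1 := mul_le_one₀ (hx a).2 (hd0 S) (hd1 S)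
            have h2 : 0 ≤ x a * d S := mul_nonneg (hx a).1 (hd0 S)
            nlinarith
      _ = (∑ S, pw x S * e S) * (c * (x a * ∑ S, pw x S * d S) + 1) := by
          congr 1
          simp only [mul_add, Finset.sum_add_distrib, mul_one, pw_sum]
          rw [add_comm, Finset.mul_sum, Finset.mul_sum]
          congr 1
          exact Finset.sum_congr rfl fun S _ => by ring
      _ ≤ Real.exp (c * ∑ S, pw x S * v (S ∩ A)) * Real.exp (c * (x a * ∑ S, pw x S * d S)) := by
          refine (mul_le_mul_of_nonneg_left (Real.add_one_le_exp _) ?_).trans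
            (mul_le_mul_of_nonneg_right ih (Real.exp_pos _).le)
          exact Finset.sum_nonneg fun S _ => mul_nonneg (pw_nonneg x hx S) (Real.exp_pos _).le
      _ = _ := by rw [← Real.exp_add, ← mul_add, hE]

lemma log_bound (u : ℝ) (hu : 0 < u) (hu1 : u ≤ 1) : (u ^ 2 - 1) / 2 ≤ u * Real.log u := by
  have h := Real.self_le_sinh_iff.2 (neg_nonneg.2 (Real.log_nonpos hu.le hu1))
  rw [Real.sinh_eq, neg_neg, Real.exp_neg, Real.exp_log hu] at h
  have h2 := mul_le_mul_of_nonneg_left h hu.le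
  have h3 : u * ((u⁻¹ - u) / 2) = (1 - u ^ 2) / 2 := by field_simp
  rw [h3] at h2
  linarith

theorem stmt8 (n : ℕ) (v : Finset (Fin n) → ℝ)
    (hmono : ∀ S T : Finset (Fin n), S ⊆ T → v S ≤ v T)
    (hsub : ∀ S T : Finset (Fin n), v S + v T ≥ v (S ∩ T) + v (S ∪ T))
    (h0 : v ∅ = 0)
    (hmarg : ∀ (S : Finset (Fin n)) (i : Fin n), v (insert i S) - v S ≤ 1)
    (x : Fin n → ℝ) (hx : ∀ j, x j ∈ Set.Icc (0:ℝ) 1)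
    (δ : ℝ) (hδ : δ ∈ Set.Ioo (0:ℝ) 1)
    (μ : ℝ) (hμ : μ = multilinear n v x) :
    (∑ S : Finset (Fin n),
        if v S ≤ (1 - δ) * μ then (∏ j ∈ S, x j) * ∏ j ∈ Sᶜ, (1 - x j) else 0) ≤
      Real.exp (-δ ^ 2 * μ / 2) := by
  have hμ' : μ = ∑ S, pw x S * v S := by
    rw [hμ, multilinear]
    exact Finset.sum_congr rfl fun S _ => mul_comm _ _
  have hv0 : ∀ S, 0 ≤ v S := fun S => h0 ▸ hmono _ _ (Finset.empty_subset S)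
  have hμ0 : 0 ≤ μ := by
    rw [hμ']
    exact Finset.sum_nonneg fun S _ => mul_nonneg (pw_nonneg x hx S) (hv0 S)
  have hu : 0 < 1 - δ := sub_pos.2 hδ.2
  have hu1 : 1 - δ ≤ 1 := by linarith [hδ.1]
  set l := Real.log (1 - δ) with hl
  have hl0 : l ≤ 0 := Real.log_nonpos hu.le hu1
  have hm := mgf_bound n v hmono hsub h0 hmarg x hx l hl0 Finset.univ
  simp only [Finset.inter_univ] at hm
  rw [← hμ', Real.exp_log hu] at hm
  calc _ ≤ ∑ S, Real.exp (-(l * ((1 - δ) * μ))) * (pw x S * Real.exp (l * v S)) := by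
        refine Finset.sum_le_sum fun S _ => ?_
        change (if v S ≤ (1 - δ) * μ then pw x S else 0) ≤ _
        have hp := pw_nonneg x hx S
        split_ifs with h
        · rw [mul_left_comm, ← Real.exp_add]
          refine le_mul_of_one_le_right hp (Real.one_le_exp ?_)
          have := mul_le_mul_of_nonpos_left h hl0
          linarith
        · positivity
    _ ≤ Real.exp (-(l * ((1 - δ) * μ))) * Real.exp ((1 - δ - 1) * μ) := by
        rw [← Finset.mul_sum]
        exact mul_le_mul_of_nonneg_left hm (Real.exp_pos _).le
    _ ≤ _ := by
        rw [← Real.exp_add]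
        refine Real.exp_le_exp.2 ?_
        have := mul_le_mul_of_nonneg_right (log_bound (1 - δ) hu hu1) hμ0
        rw [← hl] at this
        nlinarith
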